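/- Let d ≥ 1, α > 0, let μ be a probability measure on ℝᵈ with finite first moment, and let ρ₀, ρ₁ be absolutely continuous probability measures on ℝᵈ with finite second moments. Let v : ℝᵈ → ℝ be a convex differentiable function such that (∇v)_♯ρ₀ = ρ₁ and ∫ ‖∇v(x) − x‖² dρ₀(x) = W₂(ρ₀, ρ₁)², and for t ∈ [0,1] set ρ_t := ((1−t)·id + t·∇v)_♯ρ₀. Then for every t ∈ [0,1], F_μ(ρ_t) ≤ (1−t)·F_μ(ρ₀) + t·F_μ(ρ₁) − α·(t(1−t)/2)·W₂(ρ₀, ρ₁)². -/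

import Mathlib

open MeasureTheory ENNReal
open scoped RealInnerProductSpace

noncomputable section

/-- Euclidean space `ℝᵈ`. -/
abbrev Ed (d : ℕ) := EuclideanSpace ℝ (Fin d)

/-- The positive part of an extended real number, as an element of `ℝ≥0∞`. -/
noncomputable def EReal.posPart (a : EReal) : ℝ≥0∞ :=
  if a = ⊤ then ⊤ else ENNReal.ofReal a.toReal

/-- Signed integral (with values in `EReal`) of a real-valued function. -/
noncomputable def sInt {α : Type*} [MeasurableSpace α] (ν : Measure α) (g : α → ℝ) : EReal :=
  ((∫⁻ x, ENNReal.ofReal (g x) ∂ν : ℝ≥0∞) : EReal) -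
    ((∫⁻ x, ENNReal.ofReal (-(g x)) ∂ν : ℝ≥0∞) : EReal)

/-- Signed integral (with values in `EReal`) of an `EReal`-valued function. -/
noncomputable def eInt {α : Type*} [MeasurableSpace α] (ν : Measure α) (f : α → EReal) : EReal :=
  ((∫⁻ x, (f x).posPart ∂ν : ℝ≥0∞) : EReal) - ((∫⁻ x, (-(f x)).posPart ∂ν : ℝ≥0∞) : EReal)

/-- The set of couplings (transport plans) between two measures on `ℝᵈ`. -/
def couplings {d : ℕ} (ρ μ : Measure (Ed d)) : Set (Measure (Ed d × Ed d)) :=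
  {γ | IsProbabilityMeasure γ ∧ γ.map Prod.fst = ρ ∧ γ.map Prod.snd = μ}

/-- The maximal correlation functional `T(ρ, μ)`. -/
noncomputable def maxCorr {d : ℕ} (ρ μ : Measure (Ed d)) : EReal :=
  ⨆ γ ∈ couplings ρ μ, sInt γ (fun p => ⟪p.1, p.2⟫)

/-- The entropy `E(ρ)` of a measure with respect to Lebesgue measure. -/
noncomputable def Ent {d : ℕ} (ρ : Measure (Ed d)) : EReal := by
  classical
  exact if _h : ρ ≪ (volume : Measure (Ed d)) then
    sInt (volume : Measure (Ed d))
      (fun x => (ρ.rnDeriv volume x).toReal * Real.log (ρ.rnDeriv volume x).toReal)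
  else ⊤

/-- The second moment of a measure, with values in `ℝ≥0∞`. -/
noncomputable def M2e {d : ℕ} (ρ : Measure (Ed d)) : ℝ≥0∞ :=
  ∫⁻ x, ENNReal.ofReal (‖x‖ ^ 2) ∂ρ

/-- The regularized functional `F_μ(ρ) = E(ρ) + T(ρ, μ) + (α/2) M₂(ρ)`. -/
noncomputable def Ffun {d : ℕ} (α : ℝ) (μ ρ : Measure (Ed d)) : EReal :=
  Ent ρ + maxCorr ρ μ + ((α / 2 : ℝ) : EReal) * ((M2e ρ : ℝ≥0∞) : EReal)

/-- The `p`-th moment `M_p(ρ) = ∫ ‖x‖^p dρ`. -/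
noncomputable def Mp {d : ℕ} (p : ℝ) (ρ : Measure (Ed d)) : ℝ :=
  ∫ x, ‖x‖ ^ p ∂ρ

/-- The barycenter `b(ρ) = ∫ x dρ`. -/
noncomputable def bary {d : ℕ} (ρ : Measure (Ed d)) : Ed d :=
  ∫ x, x ∂ρ

/-- Probability measures on `ℝᵈ` with finite first moment. -/
def P1 (d : ℕ) : Set (Measure (Ed d)) :=
  {ρ | IsProbabilityMeasure ρ ∧ Integrable (fun x => ‖x‖) ρ}

/-- Probability measures on `ℝᵈ` with finite second moment. -/
def P2 (d : ℕ) : Set (Measure (Ed d)) :=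
  {ρ | IsProbabilityMeasure ρ ∧ Integrable (fun x => ‖x‖ ^ 2) ρ}

/-- `ρ` is a minimizer of `F_μ` over probability measures with finite first moment. -/
def IsMinOfF {d : ℕ} (α : ℝ) (μ ρ : Measure (Ed d)) : Prop :=
  ρ ∈ P1 d ∧ ∀ σ ∈ P1 d, Ffun α μ ρ ≤ Ffun α μ σ

/-- The 2-Wasserstein distance between two measures on `ℝᵈ`. -/
noncomputable def W2 {d : ℕ} (ρ μ : Measure (Ed d)) : ℝ :=
  Real.sqrt ((⨅ γ ∈ couplings ρ μ, ∫⁻ p, ENNReal.ofReal (‖p.1 - p.2‖ ^ 2) ∂γ).toReal)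

/-- Convexity of an `EReal`-valued function on `ℝᵈ`. -/
def EConvexOn {d : ℕ} (u : Ed d → EReal) : Prop :=
  ∀ x y : Ed d, ∀ s t : ℝ, 0 ≤ s → 0 ≤ t → s + t = 1 →
    u (s • x + t • y) ≤ (s : EReal) * u x + (t : EReal) * u y

/-- The Legendre transform `u*(y) = sup_x (⟨x, y⟩ - u(x))` of an `EReal`-valued function. -/
noncomputable def legendre {d : ℕ} (u : Ed d → EReal) : Ed d → EReal :=
  fun y => ⨆ x : Ed d, (((⟪x, y⟫ : ℝ) : EReal) - u x)

/-- The Gaussian-regularized density `exp(-u(x) - (α/2)‖x‖²)`, with value `0` where `u = ⊤`. -/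
noncomputable def gdens {d : ℕ} (α : ℝ) (u : Ed d → EReal) (x : Ed d) : ℝ≥0∞ :=
  if u x = ⊤ then 0 else ENNReal.ofReal (Real.exp (-(u x).toReal - (α / 2) * ‖x‖ ^ 2))

section Convex

variable {E : Type*} [NormedAddCommGroup E] [InnerProductSpace ℝ E]

/-- A convex function lies above its tangent hyperplanes. -/
theorem ConvexOn.add_inner_le_of_hasGradientAt [CompleteSpace E] {v : E → ℝ}
    (hv : ConvexOn ℝ Set.univ v) {x p : E} (hp : HasGradientAt v p x) (y : E) :
    v x + ⟪p, y - x⟫ ≤ v y := by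
  have hc : ConvexOn ℝ Set.univ (v ∘ AffineMap.lineMap (k := ℝ) x y) := by
    simpa using hv.comp_affineMap (AffineMap.lineMap (k := ℝ) x y)
  have hd : HasDerivAt (v ∘ AffineMap.lineMap (k := ℝ) x y) ⟪p, y - x⟫ 0 := by
    have h1 : HasFDerivAt v (InnerProductSpace.toDual ℝ E p)
        (AffineMap.lineMap (k := ℝ) x y 0) := by
      simpa using hp.hasFDerivAt
    simpa using h1.comp_hasDerivAt (0 : ℝ) (AffineMap.hasDerivAt_lineMap (a := x) (b := y))
  have h := hc.le_slope_of_hasDerivAt (Set.mem_univ 0) (Set.mem_univ 1) zero_lt_one hd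
  simp [slope_def_field] at h
  linarith

/-- The map `a • id + b • ∇v` is onto when `v` is convex and differentiable and `0 < a`, `0 < b`. -/
theorem ConvexOn.surjective_smul_add_smul_gradient [FiniteDimensional ℝ E] {v : E → ℝ}
    (hv : ConvexOn ℝ Set.univ v) {g : E → E} (hg : ∀ x, HasGradientAt v (g x) x)
    {a b : ℝ} (ha : 0 < a) (hb : 0 < b) (z : E) : ∃ x, a • x + b • g x = z := by
  let h : E → ℝ := fun x => a / 2 * ‖x‖ ^ 2 + b * v x - ⟪z, x⟫
  have hd : ∀ x, HasFDerivAt h ((a / 2) • (2 • innerSL ℝ x) +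
      b • (InnerProductSpace.toDual ℝ E (g x)) - innerSL ℝ z) x := by
    intro x
    exact (((hasStrictFDerivAt_norm_sq x).hasFDerivAt.const_mul (a / 2)).add
      ((hg x).hasFDerivAt.const_mul b)).sub (innerSL ℝ z).hasFDerivAt
  have hcont : Continuous h := continuous_iff_continuousAt.2 fun x => (hd x).continuousAt
  set C : ℝ := b * ‖g 0‖ + ‖z‖
  have hlow : ∀ x, ‖x‖ * (a / 2 * ‖x‖ - C) + b * v 0 ≤ h x := by
    intro x
    have h1 := hv.add_inner_le_of_hasGradientAt (hg 0) x
    rw [sub_zero] at h1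
    have h2 := neg_le_of_abs_le (abs_real_inner_le_norm (g 0) x)
    have h3 := real_inner_le_norm z x
    have h4 := mul_le_mul_of_nonneg_left (add_le_add_right h2 (v 0)) hb.le
    have h5 := mul_le_mul_of_nonneg_left h1 hb.le
    simp only [h, C]
    nlinarith
  have hlim : Filter.Tendsto h (Filter.cocompact E) Filter.atTop := by
    refine Filter.tendsto_atTop_mono hlow ?_
    have hn := tendsto_norm_cocompact_atTop (E := E)
    refine Filter.tendsto_atTop_add_const_right _ _ (hn.atTop_mul_atTop₀ ?_)
    exact Filter.tendsto_atTop_add_const_right _ (-C) (hn.const_mul_atTop (half_pos ha))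
  obtain ⟨x, hx⟩ := hcont.exists_forall_le hlim
  refine ⟨x, ?_⟩
  have hmin : IsLocalMin h x := Filter.Eventually.of_forall hx
  have h0 := hmin.hasFDerivAt_eq_zero (hd x)
  refine ext_inner_right ℝ fun w => ?_
  have := congrArg (fun L : E →L[ℝ] ℝ => L w) h0
  simp at this
  rw [inner_add_left, real_inner_smul_left, real_inner_smul_left]
  linarith

/-- Resolvent of a convex gradient: `a • id + b • ∇v` has a (Lipschitz, monotone) inverse, which is
itself a gradient. -/
theorem ConvexOn.exists_resolvent [FiniteDimensional ℝ E] {v : E → ℝ}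
    (hv : ConvexOn ℝ Set.univ v) {g : E → E} (hg : ∀ x, HasGradientAt v (g x) x)
    {a b : ℝ} (ha : 0 < a) (hb : 0 < b) :
    ∃ S : E → E, (∀ z, a • S z + b • g (S z) = z) ∧ (∀ x, S (a • x + b • g x) = x) ∧
      (∀ z w, a * ‖S z - S w‖ ^ 2 ≤ ⟪S z - S w, z - w⟫) ∧
      ∃ φ : E → ℝ, ∀ z, HasGradientAt φ (S z) z := by
  choose S hS using hv.surjective_smul_add_smul_gradient hg ha hb
  have hmonog : ∀ x y, 0 ≤ ⟪x - y, g x - g y⟫ := by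
    intro x y
    have h1 := hv.add_inner_le_of_hasGradientAt (hg x) y
    have h2 := hv.add_inner_le_of_hasGradientAt (hg y) x
    simp only [inner_sub_left, inner_sub_right] at h1 h2 ⊢
    rw [real_inner_comm (g x) x, real_inner_comm (g y) x, real_inner_comm (g x) y,
      real_inner_comm (g y) y]
    linarith
  have hT : ∀ x y, a * ‖x - y‖ ^ 2 ≤ ⟪x - y, (a • x + b • g x) - (a • y + b • g y)⟫ := by
    intro x y
    have : (a • x + b • g x) - (a • y + b • g y) = a • (x - y) + b • (g x - g y) := by module
    rw [this, inner_add_right, real_inner_smul_right, real_inner_smul_right,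
      real_inner_self_eq_norm_sq]
    nlinarith [mul_nonneg hb.le (hmonog x y)]
  have hmono : ∀ z w, a * ‖S z - S w‖ ^ 2 ≤ ⟪S z - S w, z - w⟫ := by
    intro z w
    simpa only [hS] using hT (S z) (S w)
  refine ⟨S, hS, fun x => ?_, hmono, ?_⟩
  · have h := hT (S (a • x + b • g x)) x
    rw [hS, sub_self, inner_zero_right] at h
    have h2 : ‖S (a • x + b • g x) - x‖ ^ 2 ≤ 0 := by
      by_contra hcon
      push Not at hcon
      nlinarith [mul_pos ha hcon]
    have h3 : ‖S (a • x + b • g x) - x‖ = 0 := by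
      nlinarith [norm_nonneg (S (a • x + b • g x) - x), sq_nonneg ‖S (a • x + b • g x) - x‖]
    exact sub_eq_zero.1 (norm_eq_zero.1 h3)
  let φ : E → ℝ := fun z => ⟪S z, z⟫ - a / 2 * ‖S z‖ ^ 2 - b * v (S z)
  have hsub : ∀ z w, φ z + ⟪S z, w - z⟫ ≤ φ w := by
    intro z w
    have h1 := hv.add_inner_le_of_hasGradientAt (hg (S w)) (S z)
    have h2 : 0 ≤ ‖S z - S w‖ ^ 2 := sq_nonneg _
    rw [norm_sub_sq_real] at h2
    have h3 : ⟪w, S z - S w⟫ = a * ⟪S w, S z - S w⟫ + b * ⟪g (S w), S z - S w⟫ := by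
      rw [← real_inner_smul_left, ← real_inner_smul_left, ← inner_add_left, hS]
    simp only [φ, inner_sub_right, real_inner_self_eq_norm_sq] at h1 h3 ⊢
    rw [real_inner_comm (S z) w, real_inner_comm (S w) w, real_inner_comm (S z) (S w)] at h3
    nlinarith [mul_le_mul_of_nonneg_left h1 hb.le, mul_nonneg ha.le h2]
  refine ⟨φ, fun z => ?_⟩
  rw [hasGradientAt_iff_hasFDerivAt]
  refine HasFDerivAt.of_isLittleO ?_
  have hO : (fun w => φ w - φ z - (InnerProductSpace.toDual ℝ E (S z)) (w - z))
      =O[nhds z] fun w => ‖w - z‖ ^ 2 := by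
    refine Asymptotics.IsBigO.of_bound (a⁻¹) (Filter.Eventually.of_forall fun w => ?_)
    have h1 := hsub z w
    have h2 := hsub w z
    have h3 : ⟪S w, z - w⟫ = - ⟪S w, w - z⟫ := by rw [← inner_neg_right, neg_sub]
    have h4 := hmono w z
    have h5 := real_inner_le_norm (S w - S z) (w - z)
    have h6 : ‖S w - S z‖ ≤ a⁻¹ * ‖w - z‖ := by
      rw [inv_mul_eq_div, le_div_iff₀ ha]
      by_contra hcon
      push Not at hcon
      have : 0 < ‖S w - S z‖ := by
        rcases (norm_nonneg (S w - S z)).eq_or_lt with h | h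
        · rw [← h, zero_mul] at hcon
          exact absurd hcon (not_lt.2 (norm_nonneg _))
        · exact h
      nlinarith
    rw [inner_sub_left] at h5
    rw [Real.norm_eq_abs, Real.norm_eq_abs, abs_of_nonneg (sq_nonneg ‖w - z‖),
      InnerProductSpace.toDual_apply_apply, abs_of_nonneg (by linarith)]
    nlinarith [mul_le_mul_of_nonneg_right h6 (norm_nonneg (w - z))]
  refine hO.trans_isLittleO ?_
  have h1 : (fun w => ‖w - z‖) =o[nhds z] fun _ => (1 : ℝ) := by
    rw [Asymptotics.isLittleO_one_iff]
    exact tendsto_iff_norm_sub_tendsto_zero.1 Filter.tendsto_id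
  have h2 := h1.mul_isBigO (Asymptotics.isBigO_refl (fun w => ‖w - z‖) (nhds z))
  simp only [one_mul, ← sq] at h2
  exact h2.norm_right.trans_isBigO
    (by simpa using Asymptotics.isBigO_refl (fun w => w - z) _ |>.norm_left)

end Convex

section Jacobian

variable {E : Type*} [NormedAddCommGroup E] [InnerProductSpace ℝ E] [FiniteDimensional ℝ E]

/-- Geometric concavity of the determinant for commuting symmetric nonnegative operators whose
convex combination is the identity. -/
theorem LinearMap.IsSymmetric.abs_det_rpow_mul_abs_det_rpow_le_one {A B : E →ₗ[ℝ] E}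
    (hA : A.IsSymmetric) {a b : ℝ} (ha : 0 < a) (hb : 0 < b) (hab : a + b = 1)
    (hAB : ∀ h, a • A h + b • B h = h) (hA0 : ∀ h, 0 ≤ ⟪h, A h⟫) (hB0 : ∀ h, 0 ≤ ⟪h, B h⟫) :
    |LinearMap.det A| ^ a * |LinearMap.det B| ^ b ≤ 1 := by
  set e := hA.eigenvectorBasis rfl with he
  set l := hA.eigenvalues rfl with hl
  let m : Fin (Module.finrank ℝ E) → ℝ := fun i => b⁻¹ * (1 - a * l i)
  have hAe : ∀ i, A (e i) = l i • e i := fun i => hA.apply_eigenvectorBasis rfl i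
  have hBe : ∀ i, B (e i) = m i • e i := by
    intro i
    have h1 := hAB (e i)
    rw [hAe] at h1
    have h2 : b • B (e i) = (1 - a * l i) • e i := by
      rw [sub_smul, one_smul, mul_smul]
      exact eq_sub_of_add_eq' h1
    simp only [m, mul_smul]
    rw [← h2, inv_smul_smul₀ hb.ne']
  have hl0 : ∀ i, 0 ≤ l i := by
    intro i
    have := hA0 (e i)
    rwa [hAe, real_inner_smul_right, real_inner_self_eq_norm_sq, e.orthonormal.1 i, one_pow,
      mul_one] at this
  have hm0 : ∀ i, 0 ≤ m i := by
    intro i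
    have := hB0 (e i)
    rwa [hBe, real_inner_smul_right, real_inner_self_eq_norm_sq, e.orthonormal.1 i, one_pow,
      mul_one] at this
  have hdet : ∀ (C : E →ₗ[ℝ] E) (c : Fin (Module.finrank ℝ E) → ℝ), (∀ i, C (e i) = c i • e i) →
      LinearMap.det C = ∏ i, c i := by
    intro C c hC
    rw [← LinearMap.det_toMatrix e.toBasis, ← Matrix.det_diagonal]
    congr 1
    ext i j
    rw [LinearMap.toMatrix_apply]
    simp only [OrthonormalBasis.coe_toBasis, hC, map_smul, Matrix.diagonal_apply]
    rw [← OrthonormalBasis.coe_toBasis, Finsupp.smul_apply, Module.Basis.repr_self,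
      Finsupp.single_apply]
    by_cases hij : i = j
    · simp [hij]
    · simp [hij, Ne.symm hij]
  rw [hdet A l hAe, hdet B m hBe, abs_of_nonneg (Finset.prod_nonneg fun i _ => hl0 i),
    abs_of_nonneg (Finset.prod_nonneg fun i _ => hm0 i),
    ← Real.finsetProd_rpow _ _ (fun i _ => hl0 i), ← Real.finsetProd_rpow _ _ (fun i _ => hm0 i),
    ← Finset.prod_mul_distrib]
  refine Finset.prod_le_one (fun i _ => by have := hl0 i; have := hm0 i; positivity) fun i _ => ?_
  refine (Real.geom_mean_le_arith_mean2_weighted ha.le hb.le (hl0 i) (hm0 i) hab).trans_eq ?_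
  simp only [m]
  field_simp
  ring

variable [MeasurableSpace E] [BorelSpace E]

/-- If `ρ` is the push-forward of `σ` under an almost everywhere differentiable map `Q`, then the
densities satisfy `σ ≤ (ρ ∘ Q) * |det DQ|`. -/
theorem MeasureTheory.Measure.rnDeriv_le_rnDeriv_comp_mul_abs_det {σ ρ : Measure E}
    [SigmaFinite σ] [SigmaFinite ρ] (hσ : σ ≪ volume) (hρ : ρ ≪ volume) {Q : E → E}
    (hQ : Measurable Q) (hd : ∀ᵐ z : E, DifferentiableAt ℝ Q z) (hmap : σ.map Q = ρ) :
    ∀ᵐ z : E, σ.rnDeriv volume z ≤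
      ρ.rnDeriv volume (Q z) * ENNReal.ofReal |(fderiv ℝ Q z).det| := by
  have hJ : Measurable fun z => ENNReal.ofReal |(fderiv ℝ Q z).det| :=
    ENNReal.measurable_ofReal.comp
      (continuous_abs.measurable.comp (ContinuousLinearMap.continuous_det.measurable.comp
        (measurable_fderiv ℝ Q)))
  have hD : MeasurableSet {z | DifferentiableAt ℝ Q z} := measurableSet_of_differentiableAt ℝ Q
  refine ae_le_of_forall_setLIntegral_le_of_sigmaFinite (Measure.measurable_rnDeriv _ _)
    fun s hs _ => ?_
  set s' := s ∩ {z | DifferentiableAt ℝ Q z} with hs'_def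
  have hs' : MeasurableSet s' := hs.inter hD
  have hss' : s' ≤ᵐ[volume] s ∧ s ≤ᵐ[volume] s' := by
    constructor
    · exact Filter.Eventually.of_forall fun z hz => hz.1
    · filter_upwards [hd] with z hz hzs using ⟨hzs, hz⟩
  have himage : volume.restrict (Q '' s') ≤
      ((volume.withDensity fun z => ENNReal.ofReal |(fderiv ℝ Q z).det|).restrict s').map Q := by
    refine Measure.le_iff.2 fun B hB => ?_
    rw [Measure.restrict_apply hB, Measure.map_apply hQ hB, Measure.restrict_apply (hQ hB),
      withDensity_apply _ ((hQ hB).inter hs')]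
    have : B ∩ Q '' s' = Q '' (Q ⁻¹' B ∩ s') := by
      rw [Set.inter_comm (Q ⁻¹' B), Set.image_inter_preimage, Set.inter_comm]
    rw [this]
    exact addHaar_image_le_lintegral_abs_det_fderiv volume ((hQ hB).inter hs')
      fun x hx => (DifferentiableAt.hasFDerivAt hx.2.2).hasFDerivWithinAt
  calc ∫⁻ z in s, σ.rnDeriv volume z = σ s := Measure.setLIntegral_rnDeriv hσ s
    _ ≤ σ s' := (hσ.ae_le hss'.2 : s ≤ᵐ[σ] s') |> measure_mono_ae
    _ ≤ σ (Q ⁻¹' toMeasurable ρ (Q '' s')) :=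
        measure_mono ((Set.subset_preimage_image Q s').trans
          (Set.preimage_mono (subset_toMeasurable _ _)))
    _ = ρ (Q '' s') := by
        rw [← Measure.map_apply hQ (measurableSet_toMeasurable _ _), hmap, measure_toMeasurable]
    _ = ∫⁻ y in Q '' s', ρ.rnDeriv volume y := (Measure.setLIntegral_rnDeriv hρ _).symm
    _ ≤ ∫⁻ y, ρ.rnDeriv volume y ∂((volume.withDensity
          fun z => ENNReal.ofReal |(fderiv ℝ Q z).det|).restrict s').map Q :=
        lintegral_mono' himage le_rfl
    _ = ∫⁻ z in s', ρ.rnDeriv volume (Q z) * ENNReal.ofReal |(fderiv ℝ Q z).det| := by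
        have hf : Measurable fun z => ρ.rnDeriv volume (Q z) :=
          (Measure.measurable_rnDeriv ρ volume).comp hQ
        rw [lintegral_map (Measure.measurable_rnDeriv _ _) hQ, restrict_withDensity hs',
          lintegral_withDensity_eq_lintegral_mul _ hJ hf]
        simp only [Pi.mul_apply, mul_comm]
    _ ≤ ∫⁻ z in s, ρ.rnDeriv volume (Q z) * ENNReal.ofReal |(fderiv ℝ Q z).det| :=
        lintegral_mono' (Measure.restrict_mono_ae hss'.1) le_rfl

/-- Lipschitz maps send Lebesgue null sets to Lebesgue null sets. -/
theorem LipschitzWith.volume_image_eq_zero {K : NNReal} {S : E → E} (hS : LipschitzWith K S)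
    {s : Set E} (hs : volume s = 0) : volume (S '' s) = 0 := by
  rw [← InnerProductSpace.euclideanHausdorffMeasure_eq_volume,
    Measure.euclideanHausdorffMeasure_def, Measure.smul_apply] at hs ⊢
  have h0 : Measure.hausdorffMeasure (Module.finrank ℝ E) s = 0 := by
    simpa [Measure.addHaarScalarFactor_volume_hausdorffMeasure_ne_zero] using hs
  have h1 := hS.hausdorffMeasure_image_le (d := Module.finrank ℝ E) (Nat.cast_nonneg _) s
  rw [h0, mul_zero] at h1
  rw [nonpos_iff_eq_zero.1 h1, smul_zero]

end Jacobian

section MonotoneMaps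

variable {E : Type*} [NormedAddCommGroup E] [InnerProductSpace ℝ E]

/-- The derivative of a monotone operator is nonnegative. -/
theorem HasFDerivAt.inner_nonneg_of_monotone {F : E → E} {F' : E →L[ℝ] E} {z : E}
    (hF : HasFDerivAt F F' z) (hmono : ∀ z w, 0 ≤ ⟪F z - F w, z - w⟫) (h : E) :
    0 ≤ ⟪h, F' h⟫ := by
  have hline : HasDerivAt (fun t : ℝ => z + t • h) h 0 := by
    simpa using ((hasDerivAt_id (0 : ℝ)).smul_const h).const_add z
  have hcomp : HasDerivAt (fun t : ℝ => F (z + t • h)) (F' h) 0 := by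
    refine HasFDerivAt.comp_hasDerivAt (0 : ℝ) ?_ hline
    simpa using hF
  have hd : HasDerivAt (fun t : ℝ => ⟪h, F (z + t • h)⟫) ⟪h, F' h⟫ 0 := by
    simpa using (hasDerivAt_const (0 : ℝ) h).inner ℝ hcomp
  have hm : Monotone fun t : ℝ => ⟪h, F (z + t • h)⟫ := by
    intro s t hst
    rcases hst.eq_or_lt with rfl | hlt
    · exact le_rfl
    have h1 := hmono (z + t • h) (z + s • h)
    rw [add_sub_add_left_eq_sub, ← sub_smul, real_inner_smul_right, real_inner_comm,
      inner_sub_right] at h1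
    exact sub_nonneg.1 (nonneg_of_mul_nonneg_right h1 (sub_pos.2 hlt))
  rw [← hd.deriv]
  exact hm.deriv_nonneg

/-- The derivative of a gradient map is symmetric. -/
theorem HasFDerivAt.isSymmetric_of_hasGradientAt [CompleteSpace E] {φ : E → ℝ} {S : E → E}
    {S' : E →L[ℝ] E} {z : E} (hφ : ∀ z, HasGradientAt φ (S z) z) (hS : HasFDerivAt S S' z) :
    (S' : E →ₗ[ℝ] E).IsSymmetric := by
  have hd : HasFDerivAt (fun y => InnerProductSpace.toDual ℝ E (S y))
      ((InnerProductSpace.toDual ℝ E).toContinuousLinearEquiv.toContinuousLinearMap.comp S') z :=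
    ((InnerProductSpace.toDual ℝ E).toContinuousLinearEquiv.toContinuousLinearMap.hasFDerivAt
      (x := S z)).comp z hS
  intro x y
  have h := second_derivative_symmetric (fun y => (hφ y).hasFDerivAt) hd x y
  simpa [real_inner_comm] using h

/-- If `S` is a gradient map with `a ‖S z - S w‖² ≤ ⟪S z - S w, z - w⟫` and `a • S + b • R = id`,
then the Jacobian determinants of `S` and `R` satisfy a geometric mean inequality. -/
theorem abs_det_fderiv_rpow_mul_abs_det_fderiv_rpow_le_one [FiniteDimensional ℝ E] {S R : E → E}
    {φ : E → ℝ} {a b : ℝ} (ha : 0 < a) (hb : 0 < b) (hab : a + b = 1)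
    (hSR : ∀ z, a • S z + b • R z = z)
    (hS : ∀ z w, a * ‖S z - S w‖ ^ 2 ≤ ⟪S z - S w, z - w⟫)
    (hφ : ∀ z, HasGradientAt φ (S z) z) {z : E} (hSd : DifferentiableAt ℝ S z)
    (hRd : DifferentiableAt ℝ R z) :
    |(fderiv ℝ S z).det| ^ a * |(fderiv ℝ R z).det| ^ b ≤ 1 := by
  have hSmono : ∀ z w, 0 ≤ ⟪S z - S w, z - w⟫ := fun z w =>
    (mul_nonneg ha.le (sq_nonneg _)).trans (hS z w)
  have hRmono : ∀ z w, 0 ≤ ⟪R z - R w, z - w⟫ := by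
    intro z w
    have hsplit : z - w = a • (S z - S w) + b • (R z - R w) := by
      conv_lhs => rw [← hSR z, ← hSR w]
      module
    have h1 := hS z w
    rw [hsplit, inner_add_right, real_inner_smul_right, real_inner_smul_right,
      real_inner_self_eq_norm_sq] at h1
    have h2 : 0 ≤ ⟪S z - S w, R z - R w⟫ :=
      nonneg_of_mul_nonneg_right (by linarith) hb
    rw [hsplit, inner_add_right, real_inner_smul_right, real_inner_smul_right,
      real_inner_self_eq_norm_sq, real_inner_comm]
    positivity
  have hsum : ∀ h, a • fderiv ℝ S z h + b • fderiv ℝ R z h = h := by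
    intro h
    have hd := (hSd.hasFDerivAt.const_smul a).add (hRd.hasFDerivAt.const_smul b)
    have hid : HasFDerivAt (a • S + b • R) (ContinuousLinearMap.id ℝ E) z := by
      have : a • S + b • R = id := funext hSR
      rw [this]
      exact hasFDerivAt_id z
    simpa using congrArg (fun L : E →L[ℝ] E => L h) (hd.unique hid)
  exact LinearMap.IsSymmetric.abs_det_rpow_mul_abs_det_rpow_le_one
    (hSd.hasFDerivAt.isSymmetric_of_hasGradientAt hφ) ha hb hab hsum
    (hSd.hasFDerivAt.inner_nonneg_of_monotone hSmono)
    (hRd.hasFDerivAt.inner_nonneg_of_monotone hRmono)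

theorem lipschitzWith_of_mul_norm_sq_le_inner {S : E → E} {a : ℝ} (ha : 0 < a)
    (hS : ∀ z w, a * ‖S z - S w‖ ^ 2 ≤ ⟪S z - S w, z - w⟫) :
    LipschitzWith (Real.toNNReal a⁻¹) S := by
  refine LipschitzWith.of_dist_le_mul fun z w => ?_
  rw [dist_eq_norm, dist_eq_norm, Real.coe_toNNReal _ (inv_nonneg.2 ha.le)]
  rcases (norm_nonneg (S z - S w)).eq_or_lt with h0 | hpos
  · rw [← h0]
    positivity
  have h := (hS z w).trans (real_inner_le_norm _ _)
  rw [inv_mul_eq_div, le_div_iff₀ ha]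
  nlinarith

end MonotoneMaps

section SignedIntegral

variable {X : Type*} [MeasurableSpace X] {ν : Measure X} {f h : X → ℝ}

theorem MeasureTheory.Integrable.lintegral_ofReal_ne_top (hf : Integrable f ν) :
    ∫⁻ x, ENNReal.ofReal (f x) ∂ν ≠ ⊤ := by
  refine ((lintegral_mono fun x => ?_).trans_lt hf.hasFiniteIntegral).ne
  exact Real.ofReal_le_enorm _

theorem sInt_of_integrable (hf : Integrable f ν) : sInt ν f = ((∫ x, f x ∂ν : ℝ) : EReal) := by
  have hn : ∫⁻ x, ENNReal.ofReal (-f x) ∂ν ≠ ⊤ := hf.neg.lintegral_ofReal_ne_top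
  rw [integral_eq_lintegral_pos_part_sub_lintegral_neg_part hf, EReal.coe_sub, sInt,
    EReal.coe_ennreal_toReal hf.lintegral_ofReal_ne_top,
    EReal.coe_ennreal_toReal hn]

theorem lintegral_neg_part_ne_top_of_sInt_ne_bot (hbot : sInt ν f ≠ ⊥) :
    ∫⁻ x, ENNReal.ofReal (-f x) ∂ν ≠ ⊤ := by
  intro h
  apply hbot
  rw [sInt, h, EReal.coe_ennreal_top, EReal.sub_top]

theorem sInt_ne_bot (hf : ∫⁻ x, ENNReal.ofReal (-f x) ∂ν ≠ ⊤) : sInt ν f ≠ ⊥ := by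
  rw [sInt, ← EReal.coe_ennreal_toReal hf, sub_eq_add_neg, ← EReal.coe_neg]
  simp [EReal.add_eq_bot_iff]

theorem sInt_eq_top (hp : ∫⁻ x, ENNReal.ofReal (f x) ∂ν = ⊤)
    (hn : ∫⁻ x, ENNReal.ofReal (-f x) ∂ν ≠ ⊤) : sInt ν f = ⊤ := by
  rw [sInt, hp, EReal.coe_ennreal_top, EReal.top_sub]
  simpa using hn

theorem integrable_of_lintegral_ofReal_ne_top (hm : AEStronglyMeasurable f ν)
    (hp : ∫⁻ x, ENNReal.ofReal (f x) ∂ν ≠ ⊤) (hn : ∫⁻ x, ENNReal.ofReal (-f x) ∂ν ≠ ⊤) :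
    Integrable f ν := by
  refine ⟨hm, ?_⟩
  have hle : ∀ x, ‖f x‖ₑ ≤ ENNReal.ofReal (f x) + ENNReal.ofReal (-f x) := by
    intro x
    rcases le_total 0 (f x) with h | h
    · rw [Real.enorm_of_nonneg h]
      exact le_self_add
    · rw [← enorm_neg, Real.enorm_of_nonneg (neg_nonneg.2 h)]
      exact le_add_self
  refine (lintegral_mono hle).trans_lt ?_
  rw [lintegral_add_left' hm.aemeasurable.ennreal_ofReal]
  exact ENNReal.add_lt_top.2 ⟨hp.lt_top, hn.lt_top⟩

theorem integrable_of_sInt_ne (hm : AEStronglyMeasurable f ν) (htop : sInt ν f ≠ ⊤)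
    (hbot : sInt ν f ≠ ⊥) : Integrable f ν := by
  have hn := lintegral_neg_part_ne_top_of_sInt_ne_bot hbot
  exact integrable_of_lintegral_ofReal_ne_top hm (fun hp => htop (sInt_eq_top hp hn)) hn

theorem sInt_mono_ae (hfh : f ≤ᵐ[ν] h) : sInt ν f ≤ sInt ν h := by
  refine EReal.sub_le_sub (EReal.coe_ennreal_le_coe_ennreal_iff.2 (lintegral_mono_ae ?_))
    (EReal.coe_ennreal_le_coe_ennreal_iff.2 (lintegral_mono_ae ?_))
  · filter_upwards [hfh] with x hx using ENNReal.ofReal_le_ofReal hx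
  · filter_upwards [hfh] with x hx using ENNReal.ofReal_le_ofReal (neg_le_neg hx)

theorem sInt_map {Y : Type*} [MeasurableSpace Y] {φ : X → Y} (hφ : Measurable φ) {k : Y → ℝ}
    (hk : Measurable k) : sInt (ν.map φ) k = sInt ν fun x => k (φ x) := by
  have hn : Measurable fun y => ENNReal.ofReal (-k y) := hk.neg.ennreal_ofReal
  rw [sInt, sInt, lintegral_map hk.ennreal_ofReal hφ, lintegral_map hn hφ]

/-- If two functions have integrable positive parts and a positive combination of them has an
integrable negative part, then both are integrable. -/
theorem integrable_and_integrable_of_sInt_add_ne_bot (hf : Measurable f) (hh : Measurable h)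
    {a b : ℝ} (ha : 0 < a) (hb : 0 < b)
    (hf1 : ∫⁻ x, ENNReal.ofReal (f x) ∂ν ≠ ⊤) (hh1 : ∫⁻ x, ENNReal.ofReal (h x) ∂ν ≠ ⊤)
    (hbot : sInt ν (fun x => a * f x + b * h x) ≠ ⊥) : Integrable f ν ∧ Integrable h ν := by
  have hn := lintegral_neg_part_ne_top_of_sInt_ne_bot hbot
  have key : ∀ {p q : X → ℝ} {s r : ℝ}, 0 < s → 0 < r → Measurable p → Measurable q →
      ∫⁻ x, ENNReal.ofReal (p x) ∂ν ≠ ⊤ → ∫⁻ x, ENNReal.ofReal (q x) ∂ν ≠ ⊤ →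
      ∫⁻ x, ENNReal.ofReal (-(s * p x + r * q x)) ∂ν ≠ ⊤ → Integrable p ν := by
    intro p q s r hs hr hp hq hp1 hq1 hn
    refine integrable_of_lintegral_ofReal_ne_top hp.aestronglyMeasurable hp1 ?_
    have hle : ∀ x, ENNReal.ofReal (-p x) ≤ ENNReal.ofReal s⁻¹ *
        (ENNReal.ofReal (-(s * p x + r * q x)) + ENNReal.ofReal r * ENNReal.ofReal (q x)) := by
      intro x
      rw [← ENNReal.ofReal_mul hr.le]
      refine le_trans ?_ (mul_le_mul_right ENNReal.ofReal_add_le _)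
      rw [← ENNReal.ofReal_mul (inv_pos.2 hs).le]
      refine ENNReal.ofReal_le_ofReal (le_of_eq ?_)
      field_simp
      ring
    refine ((lintegral_mono hle).trans_lt ?_).ne
    rw [lintegral_const_mul' _ _ ENNReal.ofReal_ne_top, lintegral_add_right _
      (hq.ennreal_ofReal.const_mul _), lintegral_const_mul' _ _ ENNReal.ofReal_ne_top]
    exact ENNReal.mul_lt_top ENNReal.ofReal_lt_top (ENNReal.add_lt_top.2
      ⟨hn.lt_top, ENNReal.mul_lt_top ENNReal.ofReal_lt_top hq1.lt_top⟩)
  exact ⟨key ha hb hf hh hf1 hh1 hn, key hb ha hh hf hh1 hf1 (by simpa only [add_comm] using hn)⟩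

end SignedIntegral

section Entropy

variable {d : ℕ}

theorem Ent_of_ac {ρ : Measure (Ed d)} (hρ : ρ ≪ volume) :
    Ent ρ = sInt (volume : Measure (Ed d))
      (fun x => (ρ.rnDeriv volume x).toReal * Real.log (ρ.rnDeriv volume x).toReal) := by
  rw [Ent, dif_pos hρ]

/-- The entropy of a measure with finite second moment is not `-∞`. -/
theorem Ent_ne_bot {ρ : Measure (Ed d)} (hρ : ρ ∈ P2 d) : Ent ρ ≠ ⊥ := by
  by_cases hac : ρ ≪ (volume : Measure (Ed d))
  swap
  · rw [Ent, dif_neg hac]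
    exact top_ne_bot
  have := hρ.1
  rw [Ent_of_ac hac]
  apply sInt_ne_bot
  have hgauss : Integrable (fun x : Ed d => Real.exp (-1 - ‖x‖ ^ 2)) volume := by
    have h := (GaussianFourier.integrable_cexp_neg_mul_sq_norm_add (V := Ed d) (b := 1)
      (by simp) 0 0).norm.const_mul (Real.exp (-1))
    refine h.congr (Filter.Eventually.of_forall fun x => ?_)
    simp only [Complex.norm_exp, ← Real.exp_add]
    congr 1
    norm_cast
    simp
    ring
  have hmom : Integrable (fun x => (ρ.rnDeriv volume x).toReal • ‖x‖ ^ 2)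
      (volume : Measure (Ed d)) := (integrable_rnDeriv_smul_iff hac).2 hρ.2
  refine ((lintegral_mono fun x => ENNReal.ofReal_le_ofReal ?_).trans_lt
    (hmom.add hgauss).lintegral_ofReal_ne_top.lt_top).ne
  set p := (ρ.rnDeriv volume x).toReal with hp
  have hp0 : 0 ≤ p := ENNReal.toReal_nonneg
  simp only [Pi.add_apply, smul_eq_mul]
  rcases hp0.eq_or_lt with h0 | hpos
  · rw [← hp, ← h0]
    have := Real.exp_pos (-1 - ‖x‖ ^ 2)
    simp only [zero_mul, neg_zero, zero_add]
    exact this.le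
  · rw [← hp]
    have h1 := Real.log_le_sub_one_of_pos (div_pos (Real.exp_pos (-1 - ‖x‖ ^ 2)) hpos)
    rw [Real.log_div (Real.exp_pos _).ne' hpos.ne', Real.log_exp] at h1
    have h2 := mul_le_mul_of_nonneg_left h1 hp0
    rw [mul_sub p (_ / p), mul_div_cancel₀ _ hpos.ne'] at h2
    nlinarith

/-- Convexity of the entropy along an interpolation described by two push-forwards `S`, `R` of the
intermediate measure whose Jacobian determinants satisfy the geometric mean inequality. -/
theorem Ent_le_of_map {σ ρ0 ρ1 : Measure (Ed d)} [IsProbabilityMeasure σ]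
    [IsProbabilityMeasure ρ0] [IsProbabilityMeasure ρ1] (hσ : σ ≪ (volume : Measure (Ed d)))
    (h0 : ρ0 ≪ (volume : Measure (Ed d))) (h1 : ρ1 ≪ (volume : Measure (Ed d)))
    {S R : Ed d → Ed d} (hS : Measurable S) (hR : Measurable R)
    (hSd : ∀ᵐ z : Ed d, DifferentiableAt ℝ S z) (hRd : ∀ᵐ z : Ed d, DifferentiableAt ℝ R z)
    (hSmap : σ.map S = ρ0) (hRmap : σ.map R = ρ1) {a b : ℝ} (ha : 0 < a) (hb : 0 < b)
    (hab : a + b = 1)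
    (hdet : ∀ᵐ z : Ed d, |(fderiv ℝ S z).det| ^ a * |(fderiv ℝ R z).det| ^ b ≤ 1)
    (h0top : Ent ρ0 ≠ ⊤) (h0bot : Ent ρ0 ≠ ⊥) (h1top : Ent ρ1 ≠ ⊤) (h1bot : Ent ρ1 ≠ ⊥) :
    Ent σ ≤ ((a * (Ent ρ0).toReal + b * (Ent ρ1).toReal : ℝ) : EReal) := by
  have hlog : ∀ {ρ : Measure (Ed d)} [IsProbabilityMeasure ρ], ρ ≪ (volume : Measure (Ed d)) →
      Ent ρ ≠ ⊤ → Ent ρ ≠ ⊥ →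
      Integrable (fun x => Real.log (ρ.rnDeriv volume x).toReal) ρ ∧
      (Ent ρ).toReal = ∫ x, Real.log (ρ.rnDeriv volume x).toReal ∂ρ := by
    intro ρ _ hρ htop hbot
    have hm : Measurable fun x => (ρ.rnDeriv volume x).toReal :=
      (Measure.measurable_rnDeriv ρ volume).ennreal_toReal
    rw [Ent_of_ac hρ] at htop hbot ⊢
    have h_int : Integrable (fun x => (ρ.rnDeriv volume x).toReal *
        Real.log (ρ.rnDeriv volume x).toReal) (volume : Measure (Ed d)) := integrable_of_sInt_ne
      (hm.mul (Real.measurable_log.comp hm)).aestronglyMeasurable htop hbot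
    refine ⟨(integrable_rnDeriv_smul_iff hρ).1 h_int, ?_⟩
    rw [sInt_of_integrable h_int, EReal.toReal_coe, ← integral_toReal_rnDeriv_mul hρ]
  obtain ⟨hi0, he0⟩ := hlog h0 h0top h0bot
  obtain ⟨hi1, he1⟩ := hlog h1 h1top h1bot
  have hl0 : Measurable fun x => Real.log (ρ0.rnDeriv volume x).toReal :=
    Real.measurable_log.comp (Measure.measurable_rnDeriv ρ0 volume).ennreal_toReal
  have hl1 : Measurable fun x => Real.log (ρ1.rnDeriv volume x).toReal :=
    Real.measurable_log.comp (Measure.measurable_rnDeriv ρ1 volume).ennreal_toReal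
  have hi0' : Integrable (fun z => Real.log (ρ0.rnDeriv volume (S z)).toReal) σ := by
    have h := (integrable_map_measure (μ := σ) (f := S)
      (g := fun x => Real.log (ρ0.rnDeriv volume x).toReal) hl0.aestronglyMeasurable
      hS.aemeasurable).1 (by rw [hSmap]; exact hi0)
    exact h
  have hi1' : Integrable (fun z => Real.log (ρ1.rnDeriv volume (R z)).toReal) σ := by
    have h := (integrable_map_measure (μ := σ) (f := R)
      (g := fun x => Real.log (ρ1.rnDeriv volume x).toReal) hl1.aestronglyMeasurable
      hR.aemeasurable).1 (by rw [hRmap]; exact hi1)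
    exact h
  have he0' : (Ent ρ0).toReal = ∫ z, Real.log (ρ0.rnDeriv volume (S z)).toReal ∂σ := by
    rw [he0, ← integral_map hS.aemeasurable hl0.aestronglyMeasurable, hSmap]
  have he1' : (Ent ρ1).toReal = ∫ z, Real.log (ρ1.rnDeriv volume (R z)).toReal ∂σ := by
    rw [he1, ← integral_map hR.aemeasurable hl1.aestronglyMeasurable, hRmap]
  set G : Ed d → ℝ := fun z => a * Real.log (ρ0.rnDeriv volume (S z)).toReal +
    b * Real.log (ρ1.rnDeriv volume (R z)).toReal with hG
  have hGi : Integrable G σ := (hi0'.const_mul a).add (hi1'.const_mul b)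
  have hGe : ∫ z, G z ∂σ = a * (Ent ρ0).toReal + b * (Ent ρ1).toReal := by
    rw [hG, integral_add (hi0'.const_mul a) (hi1'.const_mul b), integral_const_mul,
      integral_const_mul, he0', he1']
  have hle : ∀ᵐ z ∂σ, Real.log (σ.rnDeriv volume z).toReal ≤ G z := by
    have hS0 : ∀ᵐ z ∂σ, ρ0.rnDeriv volume (S z) < ⊤ :=
      ae_of_ae_map hS.aemeasurable (p := fun y => ρ0.rnDeriv volume y < ⊤)
        (by rw [hSmap]; exact h0.ae_le (Measure.rnDeriv_lt_top ρ0 volume))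
    have hR1 : ∀ᵐ z ∂σ, ρ1.rnDeriv volume (R z) < ⊤ :=
      ae_of_ae_map hR.aemeasurable (p := fun y => ρ1.rnDeriv volume y < ⊤)
        (by rw [hRmap]; exact h1.ae_le (Measure.rnDeriv_lt_top ρ1 volume))
    filter_upwards [Measure.rnDeriv_pos hσ, hS0, hR1, hσ.ae_le hdet,
      hσ.ae_le (Measure.rnDeriv_le_rnDeriv_comp_mul_abs_det hσ h0 hS hSd hSmap),
      hσ.ae_le (Measure.rnDeriv_le_rnDeriv_comp_mul_abs_det hσ h1 hR hRd hRmap),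
      hσ.ae_le (Measure.rnDeriv_lt_top σ volume)] with z hpos hf0 hf1 hJ hle0 hle1 htop
    have step : ∀ {f : ℝ≥0∞} {J : ℝ}, f < ⊤ → 0 ≤ J →
        σ.rnDeriv volume z ≤ f * ENNReal.ofReal J →
        0 < J ∧ Real.log (σ.rnDeriv volume z).toReal ≤ Real.log f.toReal + Real.log J := by
      intro f J hf hJ0 h
      have hr := ENNReal.toReal_mono (ENNReal.mul_ne_top hf.ne ENNReal.ofReal_ne_top) h
      rw [ENNReal.toReal_mul, ENNReal.toReal_ofReal hJ0] at hr
      have hp : 0 < (σ.rnDeriv volume z).toReal := ENNReal.toReal_pos hpos.ne' htop.ne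
      have hprod := hp.trans_le hr
      have hJpos : 0 < J := pos_of_mul_pos_right hprod ENNReal.toReal_nonneg
      have hfpos : 0 < f.toReal := pos_of_mul_pos_left hprod hJ0
      refine ⟨hJpos, ?_⟩
      rw [← Real.log_mul hfpos.ne' hJpos.ne']
      exact Real.log_le_log hp hr
    obtain ⟨hJ0, hlog0⟩ := step hf0 (abs_nonneg _) hle0
    obtain ⟨hJ1, hlog1⟩ := step hf1 (abs_nonneg _) hle1
    have hJlog := Real.log_nonpos (by positivity) hJ
    rw [Real.log_mul (Real.rpow_pos_of_pos hJ0 a).ne' (Real.rpow_pos_of_pos hJ1 b).ne',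
      Real.log_rpow hJ0, Real.log_rpow hJ1] at hJlog
    have h2 := mul_le_mul_of_nonneg_left hlog0 ha.le
    have h3 := mul_le_mul_of_nonneg_left hlog1 hb.le
    have h4 : Real.log (σ.rnDeriv volume z).toReal = a * Real.log (σ.rnDeriv volume z).toReal +
      b * Real.log (σ.rnDeriv volume z).toReal := by rw [← add_mul, hab, one_mul]
    simp only [hG]
    linarith
  have hpG : Integrable (fun z => (σ.rnDeriv volume z).toReal * G z) (volume : Measure (Ed d)) :=
    (integrable_rnDeriv_smul_iff hσ).2 hGi
  rw [Ent_of_ac hσ, ← hGe, ← integral_toReal_rnDeriv_mul hσ, ← sInt_of_integrable hpG]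
  apply sInt_mono_ae
  rw [← Measure.withDensity_rnDeriv_eq σ volume hσ,
    ae_withDensity_iff (Measure.measurable_rnDeriv σ volume)] at hle
  rw [Measure.withDensity_rnDeriv_eq σ volume hσ] at hle
  filter_upwards [hle] with z hz
  by_cases h : σ.rnDeriv volume z = 0
  · simp [h]
  · exact mul_le_mul_of_nonneg_left (hz h) ENNReal.toReal_nonneg

end Entropy

section MaximalCorrelation

variable {d : ℕ}

theorem lintegral_enorm_ne_top_of_mem_P1 {ρ : Measure (Ed d)} (hρ : ρ ∈ P1 d) :
    ∫⁻ x, ‖x‖ₑ ∂ρ ≠ ⊤ := by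
  have h := hρ.2.hasFiniteIntegral
  rw [hasFiniteIntegral_iff_enorm] at h
  simpa using h.ne

theorem mem_P1_of_mem_P2 {ρ : Measure (Ed d)} (hρ : ρ ∈ P2 d) : ρ ∈ P1 d := by
  have := hρ.1
  refine ⟨hρ.1, ((integrable_const (1 : ℝ)).add hρ.2).mono'
    continuous_norm.aestronglyMeasurable (Filter.Eventually.of_forall fun x => ?_)⟩
  simp only [norm_norm, Pi.add_apply]
  nlinarith [sq_nonneg (‖x‖ - 1), sq_nonneg ‖x‖]

theorem measurable_inner_fst_snd : Measurable fun p : Ed d × Ed d => ⟪p.1, p.2⟫ :=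
  (continuous_fst.inner continuous_snd).measurable

theorem lintegral_neg_inner_prod_ne_top {ρ μ : Measure (Ed d)} [SFinite μ]
    (hρ : ∫⁻ x, ‖x‖ₑ ∂ρ ≠ ⊤) (hμ : ∫⁻ x, ‖x‖ₑ ∂μ ≠ ⊤) :
    ∫⁻ p, ENNReal.ofReal (-⟪p.1, p.2⟫) ∂(ρ.prod μ) ≠ ⊤ := by
  have hle : ∀ p : Ed d × Ed d, ENNReal.ofReal (-⟪p.1, p.2⟫) ≤ ‖p.1‖ₑ * ‖p.2‖ₑ := by
    intro p
    rw [← ofReal_norm, ← ofReal_norm, ← ENNReal.ofReal_mul (norm_nonneg _)]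
    exact ENNReal.ofReal_le_ofReal ((neg_le_abs _).trans (abs_real_inner_le_norm _ _))
  refine ((lintegral_mono hle).trans_lt ?_).ne
  rw [lintegral_prod_mul measurable_enorm.aemeasurable measurable_enorm.aemeasurable]
  exact ENNReal.mul_lt_top hρ.lt_top hμ.lt_top

theorem maxCorr_ne_bot {ρ μ : Measure (Ed d)} (hρ : ρ ∈ P1 d) (hμ : μ ∈ P1 d) :
    maxCorr ρ μ ≠ ⊥ := by
  have := hρ.1
  have := hμ.1
  have hmem : ρ.prod μ ∈ couplings ρ μ := ⟨inferInstance, by simp, by simp⟩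
  have h := sInt_ne_bot (lintegral_neg_inner_prod_ne_top (lintegral_enorm_ne_top_of_mem_P1 hρ)
    (lintegral_enorm_ne_top_of_mem_P1 hμ))
  refine ne_bot_of_le_ne_bot h ?_
  exact le_iSup₂ (f := fun γ (_ : γ ∈ couplings ρ μ) => sInt γ fun p => ⟪p.1, p.2⟫) _ hmem

/-- If the maximal correlation is not `+∞`, the positive part of the correlation is integrable for
every coupling: otherwise decouple the marginals where the correlation is negative. -/
theorem lintegral_inner_ne_top_of_maxCorr_ne_top {ρ μ : Measure (Ed d)} (hρ : ρ ∈ P1 d)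
    (hμ : μ ∈ P1 d) (htop : maxCorr ρ μ ≠ ⊤) {γ : Measure (Ed d × Ed d)}
    (hγ : γ ∈ couplings ρ μ) : ∫⁻ p, ENNReal.ofReal ⟪p.1, p.2⟫ ∂γ ≠ ⊤ := by
  intro hinf
  apply htop
  have := hρ.1
  have := hμ.1
  have := hγ.1
  have hle : ∀ γ' ∈ couplings ρ μ, sInt γ' (fun p => ⟪p.1, p.2⟫) = ⊤ → maxCorr ρ μ = ⊤ := by
    intro γ' hγ' h
    refine top_le_iff.1 (h.symm.le.trans ?_)
    exact le_iSup₂ (f := fun γ (_ : γ ∈ couplings ρ μ) => sInt γ fun p => ⟪p.1, p.2⟫) _ hγ'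
  set N : Set (Ed d × Ed d) := {p | ⟪p.1, p.2⟫ < 0} with hN_def
  have hN : MeasurableSet N := measurableSet_lt measurable_inner_fst_snd measurable_const
  set ν := γ.restrict N with hν
  have hneg : ∫⁻ p, ENNReal.ofReal (-⟪p.1, p.2⟫) ∂(γ.restrict Nᶜ) = 0 := by
    have hmn : Measurable fun p : Ed d × Ed d => ENNReal.ofReal (-⟪p.1, p.2⟫) :=
      measurable_inner_fst_snd.neg.ennreal_ofReal
    rw [lintegral_eq_zero_iff hmn]
    filter_upwards [ae_restrict_mem hN.compl] with p hp
    simp only [hN_def, Set.mem_compl_iff, Set.mem_ofPred_eq, not_lt] at hp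
    simpa using hp
  have hpos : ∫⁻ p, ENNReal.ofReal ⟪p.1, p.2⟫ ∂(γ.restrict Nᶜ) = ⊤ := by
    have h0 : ∫⁻ p, ENNReal.ofReal ⟪p.1, p.2⟫ ∂ν = 0 := by
      rw [lintegral_eq_zero_iff measurable_inner_fst_snd.ennreal_ofReal]
      filter_upwards [ae_restrict_mem hN] with p hp
      simpa using le_of_lt hp
    have h := lintegral_add_compl (μ := γ) (fun p => ENNReal.ofReal ⟪p.1, p.2⟫) hN
    rwa [← hν, h0, zero_add, hinf] at h
  set m := ν Set.univ with hm
  by_cases hm0 : m = 0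
  · refine hle γ hγ (sInt_eq_top hinf ?_)
    have hν0 : ν = 0 := Measure.measure_univ_eq_zero.1 hm0
    have h := lintegral_add_compl (μ := γ) (fun p => ENNReal.ofReal (-⟪p.1, p.2⟫)) hN
    rw [hneg, ← hν, hν0, lintegral_zero_measure, zero_add] at h
    rw [← h]
    exact ENNReal.zero_ne_top
  have hmtop : m ≠ ⊤ := measure_ne_top _ _
  have hmfst : (ν.map Prod.fst) Set.univ = m := by
    rw [Measure.map_apply measurable_fst MeasurableSet.univ, Set.preimage_univ]
  have hmsnd : (ν.map Prod.snd) Set.univ = m := by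
    rw [Measure.map_apply measurable_snd MeasurableSet.univ, Set.preimage_univ]
  set γ' := γ.restrict Nᶜ + m⁻¹ • (ν.map Prod.fst).prod (ν.map Prod.snd) with hγ'
  have hfst : γ'.map Prod.fst = ρ := by
    rw [hγ', Measure.map_add _ _ measurable_fst, Measure.map_smul, Measure.map_fst_prod, hmsnd,
      smul_smul, ENNReal.inv_mul_cancel hm0 hmtop, one_smul, ← Measure.map_add _ _ measurable_fst,
      add_comm, Measure.restrict_add_restrict_compl hN, hγ.2.1]
  have hsnd : γ'.map Prod.snd = μ := by
    rw [hγ', Measure.map_add _ _ measurable_snd, Measure.map_smul, Measure.map_snd_prod, hmfst,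
      smul_smul, ENNReal.inv_mul_cancel hm0 hmtop, one_smul, ← Measure.map_add _ _ measurable_snd,
      add_comm, Measure.restrict_add_restrict_compl hN, hγ.2.2]
  have hprob : IsProbabilityMeasure γ' := by
    refine ⟨?_⟩
    rw [← Set.preimage_univ (f := Prod.fst), ← Measure.map_apply measurable_fst MeasurableSet.univ,
      hfst, measure_univ]
  refine hle γ' ⟨hprob, hfst, hsnd⟩ (sInt_eq_top ?_ ?_)
  · rw [hγ', lintegral_add_measure, hpos, top_add]
  · rw [hγ', lintegral_add_measure, hneg, zero_add, lintegral_smul_measure, smul_eq_mul]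
    refine ENNReal.mul_ne_top (ENNReal.inv_ne_top.2 hm0) (lintegral_neg_inner_prod_ne_top ?_ ?_)
    · refine ne_top_of_le_ne_top (lintegral_enorm_ne_top_of_mem_P1 hρ) ?_
      rw [← hγ.2.1]
      exact lintegral_mono' (Measure.map_mono Measure.restrict_le_self measurable_fst) le_rfl
    · refine ne_top_of_le_ne_top (lintegral_enorm_ne_top_of_mem_P1 hμ) ?_
      rw [← hγ.2.2]
      exact lintegral_mono' (Measure.map_mono Measure.restrict_le_self measurable_snd) le_rfl

/-- Convexity of the maximal correlation functional along an interpolation described by two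
push-forwards of the intermediate measure. -/
theorem maxCorr_le_of_map {σ ρ0 ρ1 μ : Measure (Ed d)} (h0 : ρ0 ∈ P1 d) (h1 : ρ1 ∈ P1 d)
    (hμ : μ ∈ P1 d) {S R : Ed d → Ed d} (hS : Measurable S) (hR : Measurable R)
    (hSmap : σ.map S = ρ0) (hRmap : σ.map R = ρ1) {a b : ℝ} (ha : 0 < a) (hb : 0 < b)
    (hSR : ∀ z, a • S z + b • R z = z)
    (h0top : maxCorr ρ0 μ ≠ ⊤) (h1top : maxCorr ρ1 μ ≠ ⊤) :
    maxCorr σ μ ≤ ((a * (maxCorr ρ0 μ).toReal + b * (maxCorr ρ1 μ).toReal : ℝ) : EReal) := by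
  refine iSup₂_le fun γ hγ => ?_
  have := hγ.1
  have hcoup : ∀ {Q : Ed d → Ed d} {ρ : Measure (Ed d)}, Measurable Q → σ.map Q = ρ →
      γ.map (fun p => (Q p.1, p.2)) ∈ couplings ρ μ := by
    intro Q ρ hQ hmap
    have hm : Measurable fun p : Ed d × Ed d => (Q p.1, p.2) :=
      (hQ.comp measurable_fst).prodMk measurable_snd
    refine ⟨Measure.isProbabilityMeasure_map hm.aemeasurable, ?_, ?_⟩
    · rw [Measure.map_map measurable_fst hm, ← hmap, ← hγ.2.1, Measure.map_map hQ measurable_fst]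
      rfl
    · rw [Measure.map_map measurable_snd hm, ← hγ.2.2]
      rfl
  have hmeas : ∀ {Q : Ed d → Ed d}, Measurable Q →
      Measurable fun p : Ed d × Ed d => ⟪Q p.1, p.2⟫ := fun hQ =>
    (hQ.comp measurable_fst).inner measurable_snd
  have hfin : ∀ {Q : Ed d → Ed d} {ρ : Measure (Ed d)}, ρ ∈ P1 d → Measurable Q → σ.map Q = ρ →
      maxCorr ρ μ ≠ ⊤ → ∫⁻ p, ENNReal.ofReal ⟪Q p.1, p.2⟫ ∂γ ≠ ⊤ := by
    intro Q ρ hρ hQ hmap htop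
    have h := lintegral_inner_ne_top_of_maxCorr_ne_top hρ hμ htop (hcoup hQ hmap)
    have hm : Measurable fun p : Ed d × Ed d => (Q p.1, p.2) :=
      (hQ.comp measurable_fst).prodMk measurable_snd
    rwa [lintegral_map measurable_inner_fst_snd.ennreal_ofReal hm] at h
  have hbound : ∀ {Q : Ed d → Ed d} {ρ : Measure (Ed d)}, ρ ∈ P1 d → Measurable Q →
      σ.map Q = ρ → maxCorr ρ μ ≠ ⊤ → Integrable (fun p : Ed d × Ed d => ⟪Q p.1, p.2⟫) γ →
      ∫ p, ⟪Q p.1, p.2⟫ ∂γ ≤ (maxCorr ρ μ).toReal := by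
    intro Q ρ hρ hQ hmap htop h_int
    have hm : Measurable fun p : Ed d × Ed d => (Q p.1, p.2) :=
      (hQ.comp measurable_fst).prodMk measurable_snd
    have hmap' := sInt_map (ν := γ) hm measurable_inner_fst_snd
    rw [← EReal.coe_le_coe_iff, EReal.coe_toReal htop (maxCorr_ne_bot hρ hμ),
      ← sInt_of_integrable h_int]
    refine hmap'.symm.le.trans ?_
    exact le_iSup₂ (f := fun γ (_ : γ ∈ couplings ρ μ) => sInt γ fun p => ⟪p.1, p.2⟫) _
      (hcoup hQ hmap)
  have heq : (fun p : Ed d × Ed d => ⟪p.1, p.2⟫) =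
      fun p => a * ⟪S p.1, p.2⟫ + b * ⟪R p.1, p.2⟫ := by
    funext p
    rw [← real_inner_smul_left, ← real_inner_smul_left, ← inner_add_left, hSR]
  rw [heq]
  by_cases hbot : sInt γ (fun p => a * ⟪S p.1, p.2⟫ + b * ⟪R p.1, p.2⟫) = ⊥
  · rw [hbot]
    exact bot_le
  obtain ⟨hi0, hi1⟩ := integrable_and_integrable_of_sInt_add_ne_bot (hmeas hS) (hmeas hR) ha hb
    (hfin h0 hS hSmap h0top) (hfin h1 hR hRmap h1top) hbot
  have hi : Integrable (fun p : Ed d × Ed d => a * ⟪S p.1, p.2⟫ + b * ⟪R p.1, p.2⟫) γ :=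
    (hi0.const_mul a).add (hi1.const_mul b)
  rw [sInt_of_integrable hi, EReal.coe_le_coe_iff,
    integral_add (hi0.const_mul a) (hi1.const_mul b), integral_const_mul, integral_const_mul]
  exact add_le_add (mul_le_mul_of_nonneg_left (hbound h0 hS hSmap h0top hi0) ha.le)
    (mul_le_mul_of_nonneg_left (hbound h1 hR hRmap h1top hi1) hb.le)

end MaximalCorrelation

section SecondMoment

variable {d : ℕ}

theorem coe_M2e {ρ : Measure (Ed d)} (hρ : Integrable (fun x => ‖x‖ ^ 2) ρ) :
    ((M2e ρ : ℝ≥0∞) : EReal) = ((∫ x, ‖x‖ ^ 2 ∂ρ : ℝ) : EReal) := by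
  rw [M2e, ← ofReal_integral_eq_lintegral_ofReal hρ
    (Filter.Eventually.of_forall fun x => sq_nonneg ‖x‖), EReal.coe_ennreal_ofReal,
    max_eq_left (integral_nonneg fun x => sq_nonneg ‖x‖)]

/-- The second moment along an interpolation between `ρ` and its push-forward under `g`. -/
theorem integrable_and_integral_norm_sq_map_add {ρ : Measure (Ed d)} {g : Ed d → Ed d}
    (hg : AEMeasurable g ρ) (h0 : Integrable (fun x => ‖x‖ ^ 2) ρ)
    (h1 : Integrable (fun x => ‖x‖ ^ 2) (ρ.map g)) {a b : ℝ} (hab : a + b = 1) :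
    Integrable (fun x => ‖x‖ ^ 2) (ρ.map fun x => a • x + b • g x) ∧
      ∫ x, ‖x‖ ^ 2 ∂(ρ.map fun x => a • x + b • g x) =
        a * ∫ x, ‖x‖ ^ 2 ∂ρ + b * ∫ x, ‖x‖ ^ 2 ∂(ρ.map g) - a * b * ∫ x, ‖g x - x‖ ^ 2 ∂ρ := by
  have hsq : Continuous fun x : Ed d => ‖x‖ ^ 2 := by fun_prop
  have hT : AEMeasurable (fun x => a • x + b • g x) ρ :=
    (aemeasurable_id.const_smul a).add (hg.const_smul b)
  have hi1 : Integrable (fun x => ‖g x‖ ^ 2) ρ :=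
    (integrable_map_measure hsq.aestronglyMeasurable hg).1 h1
  have hid : Integrable (fun x => ‖g x - x‖ ^ 2) ρ := by
    refine ((hi1.const_mul 2).add (h0.const_mul 2)).mono'
      ((hg.sub aemeasurable_id).norm.pow_const 2).aestronglyMeasurable
      (Filter.Eventually.of_forall fun x => ?_)
    have h := parallelogram_law_with_norm ℝ (g x) x
    rw [Real.norm_of_nonneg (sq_nonneg _)]
    simp only [Pi.add_apply]
    nlinarith [mul_self_nonneg ‖g x + x‖]
  have hexp : ∀ x, ‖a • x + b • g x‖ ^ 2 =
      a * ‖x‖ ^ 2 + b * ‖g x‖ ^ 2 - a * b * ‖g x - x‖ ^ 2 := by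
    intro x
    rw [norm_add_sq_real, norm_sub_sq_real, norm_smul, norm_smul, mul_pow, mul_pow,
      real_inner_smul_left, real_inner_smul_right, real_inner_comm x (g x), Real.norm_eq_abs,
      Real.norm_eq_abs, sq_abs, sq_abs]
    obtain rfl : b = 1 - a := by linarith
    ring
  have hi01 : Integrable (fun x => a * ‖x‖ ^ 2 + b * ‖g x‖ ^ 2) ρ :=
    (h0.const_mul a).add (hi1.const_mul b)
  have hi : Integrable
      (fun x => a * ‖x‖ ^ 2 + b * ‖g x‖ ^ 2 - a * b * ‖g x - x‖ ^ 2) ρ :=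
    hi01.sub (hid.const_mul (a * b))
  refine ⟨(integrable_map_measure hsq.aestronglyMeasurable hT).2
    (hi.congr (Filter.Eventually.of_forall fun x => (hexp x).symm)), ?_⟩
  rw [integral_map hT hsq.aestronglyMeasurable, integral_map hg hsq.aestronglyMeasurable]
  simp_rw [hexp]
  rw [integral_sub hi01 (hid.const_mul (a * b)),
    integral_add (h0.const_mul a) (hi1.const_mul b), integral_const_mul, integral_const_mul,
    integral_const_mul]

end SecondMoment

theorem EReal.coe_mul_ne_bot {a : ℝ} (ha : 0 < a) {x : EReal} (hx : x ≠ ⊥) :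
    (a : EReal) * x ≠ ⊥ := by
  induction x with
  | bot => exact absurd rfl hx
  | coe x => exact EReal.coe_ne_bot (a * x)
  | top => rw [EReal.coe_mul_top_of_pos ha]; exact top_ne_bot

section Functional

variable {d : ℕ}

theorem Ffun_ne_bot {α : ℝ} {μ ρ : Measure (Ed d)} (hμ : μ ∈ P1 d) (hρ : ρ ∈ P2 d) :
    Ffun α μ ρ ≠ ⊥ := by
  rw [Ffun, coe_M2e hρ.2, ← EReal.coe_mul, Ne, EReal.add_eq_bot_iff, EReal.add_eq_bot_iff, not_or,
    not_or]
  exact ⟨⟨Ent_ne_bot hρ, maxCorr_ne_bot (mem_P1_of_mem_P2 hρ) hμ⟩, EReal.coe_ne_bot _⟩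

theorem ne_top_of_Ffun_ne_top {α : ℝ} {μ ρ : Measure (Ed d)} (hμ : μ ∈ P1 d) (hρ : ρ ∈ P2 d)
    (h : Ffun α μ ρ ≠ ⊤) : Ent ρ ≠ ⊤ ∧ maxCorr ρ μ ≠ ⊤ := by
  rw [Ffun, coe_M2e hρ.2, ← EReal.coe_mul] at h
  constructor
  · intro hE
    rw [hE, EReal.top_add_of_ne_bot (maxCorr_ne_bot (mem_P1_of_mem_P2 hρ) hμ),
      EReal.top_add_coe] at h
    exact h rfl
  · intro hT
    rw [hT, EReal.add_top_of_ne_bot (Ent_ne_bot hρ), EReal.top_add_coe] at h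
    exact h rfl

theorem Ffun_eq_coe {α : ℝ} {μ ρ : Measure (Ed d)} (hμ : μ ∈ P1 d) (hρ : ρ ∈ P2 d)
    (hE : Ent ρ ≠ ⊤) (hT : maxCorr ρ μ ≠ ⊤) :
    Ffun α μ ρ = (((Ent ρ).toReal + (maxCorr ρ μ).toReal + α / 2 * ∫ x, ‖x‖ ^ 2 ∂ρ : ℝ) :
      EReal) := by
  rw [Ffun, coe_M2e hρ.2, EReal.coe_add, EReal.coe_add, EReal.coe_mul,
    EReal.coe_toReal hE (Ent_ne_bot hρ),
    EReal.coe_toReal hT (maxCorr_ne_bot (mem_P1_of_mem_P2 hρ) hμ)]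

/-- Strong convexity of `F_μ` at an interior point of the displacement interpolation. -/
theorem Ffun_map_add_le {α : ℝ} {μ ρ0 ρ1 : Measure (Ed d)} (hμ : μ ∈ P1 d) (h0 : ρ0 ∈ P2 d)
    (h1 : ρ1 ∈ P2 d) (hac0 : ρ0 ≪ (volume : Measure (Ed d)))
    (hac1 : ρ1 ≪ (volume : Measure (Ed d))) {v : Ed d → ℝ} (hconv : ConvexOn ℝ Set.univ v)
    {g : Ed d → Ed d} (hg : ∀ x, HasGradientAt v (g x) x) (hpush : ρ0.map g = ρ1)
    {a b : ℝ} (ha : 0 < a) (hb : 0 < b) (hab : a + b = 1) :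
    Ffun α μ (ρ0.map fun x => a • x + b • g x) ≤ (a : EReal) * Ffun α μ ρ0 +
      (b : EReal) * Ffun α μ ρ1 - ((α / 2 * (a * b * ∫ x, ‖g x - x‖ ^ 2 ∂ρ0) : ℝ) : EReal) := by
  have := h0.1
  have := h1.1
  have hn0 := EReal.coe_mul_ne_bot ha (Ffun_ne_bot (α := α) hμ h0)
  have hn1 := EReal.coe_mul_ne_bot hb (Ffun_ne_bot (α := α) hμ h1)
  by_cases hF0 : Ffun α μ ρ0 = ⊤
  · rw [hF0, EReal.coe_mul_top_of_pos ha, EReal.top_add_of_ne_bot hn1, EReal.top_sub_coe]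
    exact le_top
  by_cases hF1 : Ffun α μ ρ1 = ⊤
  · rw [hF1, EReal.coe_mul_top_of_pos hb, EReal.add_top_of_ne_bot hn0, EReal.top_sub_coe]
    exact le_top
  obtain ⟨hE0, hT0⟩ := ne_top_of_Ffun_ne_top hμ h0 hF0
  obtain ⟨hE1, hT1⟩ := ne_top_of_Ffun_ne_top hμ h1 hF1
  have hgm : AEMeasurable g ρ0 := by
    by_contra h
    rw [Measure.map_of_not_aemeasurable h] at hpush
    exact IsProbabilityMeasure.ne_zero ρ1 hpush.symm
  have hTm : AEMeasurable (fun x => a • x + b • g x) ρ0 :=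
    (aemeasurable_id.const_smul a).add (hgm.const_smul b)
  obtain ⟨S, -, hSx, hSmono, φ, hφ⟩ := hconv.exists_resolvent hg ha hb
  have hSlip := lipschitzWith_of_mul_norm_sq_le_inner ha hSmono
  have hSm : Measurable S := hSlip.continuous.measurable
  set R : Ed d → Ed d := fun z => b⁻¹ • (z - a • S z) with hR
  have hRm : Measurable R := (measurable_id.sub (hSm.const_smul a)).const_smul b⁻¹
  have hSR : ∀ z, a • S z + b • R z = z := fun z => by
    rw [hR, smul_inv_smul₀ hb.ne', add_sub_cancel]
  have hRx : ∀ x, R (a • x + b • g x) = g x := fun x => by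
    simp only [hR]
    rw [hSx, add_sub_cancel_left, inv_smul_smul₀ hb.ne']
  have hSd : ∀ᵐ z : Ed d, DifferentiableAt ℝ S z := hSlip.ae_differentiableAt
  have hRd' : ∀ z, DifferentiableAt ℝ S z → DifferentiableAt ℝ R z := fun z h =>
    (differentiableAt_id.sub (h.const_smul a)).const_smul b⁻¹
  have hRd : ∀ᵐ z : Ed d, DifferentiableAt ℝ R z := hSd.mono hRd'
  have hdet : ∀ᵐ z : Ed d, |(fderiv ℝ S z).det| ^ a * |(fderiv ℝ R z).det| ^ b ≤ 1 :=
    hSd.mono fun z h => abs_det_fderiv_rpow_mul_abs_det_fderiv_rpow_le_one ha hb hab hSR hSmono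
      hφ h (hRd' z h)
  obtain ⟨hi, hM⟩ := integrable_and_integral_norm_sq_map_add hgm h0.2 (hpush.symm ▸ h1.2) hab
  set σ := ρ0.map fun x => a • x + b • g x with hσ
  have hσP : IsProbabilityMeasure σ := Measure.isProbabilityMeasure_map hTm
  have hSmap : σ.map S = ρ0 := by
    rw [hσ, AEMeasurable.map_map_of_aemeasurable hSm.aemeasurable hTm]
    have : S ∘ (fun x => a • x + b • g x) = id := funext hSx
    rw [this, Measure.map_id]
  have hRmap : σ.map R = ρ1 := by
    rw [hσ, AEMeasurable.map_map_of_aemeasurable hRm.aemeasurable hTm, ← hpush]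
    congr 1
    exact funext hRx
  have hσac : σ ≪ (volume : Measure (Ed d)) := by
    refine Measure.AbsolutelyContinuous.mk fun s hs hs0 => ?_
    rw [hσ, Measure.map_apply_of_aemeasurable hTm hs]
    have hsub : (fun x => a • x + b • g x) ⁻¹' s ⊆ S '' s := fun x hx => ⟨_, hx, hSx x⟩
    exact measure_mono_null hsub (hac0 (hSlip.volume_image_eq_zero hs0))
  have hEle := Ent_le_of_map hσac hac0 hac1 hSm hRm hSd hRd hSmap hRmap ha hb hab hdet hE0
    (Ent_ne_bot h0) hE1 (Ent_ne_bot h1)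
  have hTle := maxCorr_le_of_map (mem_P1_of_mem_P2 h0) (mem_P1_of_mem_P2 h1) hμ hSm hRm hSmap
    hRmap ha hb hSR hT0 hT1
  rw [Ffun_eq_coe hμ h0 hE0 hT0, Ffun_eq_coe hμ h1 hE1 hT1, Ffun, coe_M2e hi, hM, hpush]
  refine (add_le_add (add_le_add hEle hTle) le_rfl).trans (le_of_eq ?_)
  norm_cast
  ring

end Functional

/-- strong geodesic convexity of `F_μ` along 2-Wasserstein geodesics. -/
theorem stmt15 (d : ℕ) (hd : 1 ≤ d) (α : ℝ) (hα : 0 < α)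
    (μ : Measure (Ed d)) (hμ : μ ∈ P1 d)
    (ρ0 ρ1 : Measure (Ed d)) (h0 : ρ0 ∈ P2 d) (h1 : ρ1 ∈ P2 d)
    (hac0 : ρ0 ≪ (volume : Measure (Ed d))) (hac1 : ρ1 ≪ (volume : Measure (Ed d)))
    (v : Ed d → ℝ) (hconv : ConvexOn ℝ Set.univ v)
    (g : Ed d → Ed d) (hg : ∀ x, HasGradientAt v (g x) x)
    (hpush : ρ0.map g = ρ1)
    (hopt : ∫ x, ‖g x - x‖ ^ 2 ∂ρ0 = (W2 ρ0 ρ1) ^ 2) :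
    ∀ t : ℝ, t ∈ Set.Icc (0 : ℝ) 1 →
      Ffun α μ (ρ0.map (fun x => (1 - t) • x + t • g x)) ≤
        ((1 - t : ℝ) : EReal) * Ffun α μ ρ0 + ((t : ℝ) : EReal) * Ffun α μ ρ1 -
          ((α * (t * (1 - t) / 2) * (W2 ρ0 ρ1) ^ 2 : ℝ) : EReal) := by
  have := h0.1
  have hid : ρ0.map (fun x => x) = ρ0 := Measure.map_id
  rintro t ⟨ht0, ht1⟩
  rcases ht0.eq_or_lt with rfl | ht0
  · simp [hid]
  rcases ht1.eq_or_lt with rfl | ht1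
  · simp [hpush]
  have h := Ffun_map_add_le (α := α) hμ h0 h1 hac0 hac1 hconv hg hpush (sub_pos.2 ht1) ht0
    (sub_add_cancel 1 t)
  rw [hopt] at h
  convert h using 3
  ring
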